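/- arXiv:1302.7127 — 6 statements merged into one kernel-verified Lean document; each statement's English description precedes it below -/
import Mathlib

section
/- Let χ be an order type in general position on a finite set V with |V| = n ≥ 4, and let u, v, w be pairwise distinct non-hull elements of χ. Suppose h is a hull element such that both u and w occur before v in a hull surrounding sequence of h. Let w_1, …, w_{n−1} be a cyclic shift, starting at w_1 = h, of an internal surrounding sequence of v. Then χ(u, v, w) = +1 if and only if u occurs before w in the sequence w_1, …, w_{n−1}. -/
/-- The 2×2 determinant of two vectors in `ℝ²`. -/
def det2 (x y : ℝ × ℝ) : ℝ := x.1 * y.2 - x.2 * y.1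

/-- An order type in general position on `V`: values in `{-1,+1}` on pairwise distinct
triples and `0` otherwise, alternating, and satisfying the GP axiom. -/
def IsOrderType {V : Type*} (χ : V → V → V → ℤ) : Prop :=
  (∀ a b c : V, a ≠ b → a ≠ c → b ≠ c → χ a b c = 1 ∨ χ a b c = -1) ∧
  (∀ a b c : V, a = b ∨ a = c ∨ b = c → χ a b c = 0) ∧
  (∀ a b c : V, χ b a c = -χ a b c) ∧
  (∀ a b c : V, χ a c b = -χ a b c) ∧
  (∀ x a b c d : V, x ≠ a → x ≠ b → x ≠ c → x ≠ d → a ≠ b → a ≠ c → a ≠ d →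
    b ≠ c → b ≠ d → c ≠ d →
    ((χ x a b * χ x c d = -1 ∨ -(χ x a c * χ x b d) = -1 ∨ χ x a d * χ x b c = -1) ∧
     (χ x a b * χ x c d = 1 ∨ -(χ x a c * χ x b d) = 1 ∨ χ x a d * χ x b c = 1)))

/-- A convex hull sequence of `χ`: a cyclic sequence `h 0, …, h (t-1)` (`t ≥ 3`) of distinct
elements with `χ (h i) (h (i+1)) v = 1` for every `i` (mod `t`) and every other `v`. -/
def IsConvexHullSeq {V : Type*} (χ : V → V → V → ℤ) (t : ℕ) (h : ZMod t → V) : Prop :=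
  3 ≤ t ∧ Function.Injective h ∧
  ∀ i : ZMod t, ∀ v : V, v ≠ h i → v ≠ h (i + 1) → χ (h i) (h (i + 1)) v = 1

/-- A hull element: an element appearing in some convex hull sequence of `χ`. -/
def IsHullElement {V : Type*} (χ : V → V → V → ℤ) (x : V) : Prop :=
  ∃ (t : ℕ) (h : ZMod t → V), IsConvexHullSeq χ t h ∧ x ∈ Set.range h

/-- A hull surrounding sequence of a hull element `h`: an enumeration of `V \ {h}` with
`χ v_j h v_{j+1} = 1` for consecutive entries. -/
def IsHullSurroundSeq {V : Type*} (χ : V → V → V → ℤ) (h : V) (s : List V) : Prop :=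
  s.Nodup ∧ (∀ x : V, x ∈ s ↔ x ≠ h) ∧ s.Chain' (fun a b => χ a h b = 1)

/-- An internal surrounding sequence of a non-hull element `v`: an enumeration of `V \ {v}`
which is cyclically `χ`-increasing around `v`, and with exactly one sign change of
`χ v₁ v ·` along the sequence. -/
def IsInternalSurroundSeq {V : Type*} (χ : V → V → V → ℤ) (v : V) (s : List V) : Prop :=
  s.Nodup ∧ (∀ x : V, x ∈ s ↔ x ≠ v) ∧
  s.Chain' (fun a b => χ a v b = 1) ∧
  (∀ a b : V, s.getLast? = some a → s.head? = some b → χ a v b = 1) ∧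
  ∃! p : ℕ, 0 < p ∧ p + 1 < s.length ∧
    (∀ j : ℕ, 0 < j → j ≤ p → χ (s.getD 0 v) v (s.getD j v) = 1) ∧
    (∀ j : ℕ, p < j → j < s.length → χ (s.getD 0 v) v (s.getD j v) = -1)

/-- The cyclic triangle `h₁, h₂, h₃` as a map `ZMod 3 → V`. -/
def tripleHull {V : Type*} (h₁ h₂ h₃ : V) : ZMod 3 → V :=
  fun i => if i = 0 then h₁ else if i = 1 then h₂ else h₃

/-- The wheel graph `W_v` on `V` determined by the surrounding sequence `s` of `v`:
the cycle through consecutive entries of `s` (taken cyclically) plus all spokes from `v`. -/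
def wheelGraph {V : Type*} (v : V) (s : List V) : SimpleGraph V :=
  SimpleGraph.fromRel (fun a b =>
    (a = v ∧ b ∈ s) ∨
    (∃ i : ℕ, i + 1 < s.length ∧ s.getD i v = a ∧ s.getD (i + 1) v = b) ∨
    (s.getLast? = some a ∧ s.head? = some b))

/-- The vertex set of `T_v`: the four frame vertices `t₁,…,t₄` together with three copies
of the non-hull elements. -/
def TVert (V : Type*) (h₁ h₂ h₃ : V) : Type _ :=
  Fin 4 ⊕ ({x : V // x ≠ h₁ ∧ x ≠ h₂ ∧ x ≠ h₃} × Fin 3)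

/-- The embedding of copy `i` of `V` into the vertex set of `T_v`: a non-hull element `u`
goes to `(u, i)`; the hull `h₁,h₂,h₃` is mapped (with `t₁,t₂,t₃,t₄` being `0,1,2,3`) to
`t₁,t₄,t₃` for copy `0`, to `t₂,t₄,t₁` for copy `1`, and to `t₃,t₄,t₂` for copy `2`. -/
def copyMap {V : Type*} [DecidableEq V] (h₁ h₂ h₃ : V) (i : Fin 3) (u : V) :
    TVert V h₁ h₂ h₃ :=
  if hu : u ≠ h₁ ∧ u ≠ h₂ ∧ u ≠ h₃ then Sum.inr (⟨u, hu⟩, i)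
  else if u = h₂ then Sum.inl 3
  else if u = h₁ then Sum.inl (Fin.castLE (by norm_num) i)
  else Sum.inl (Fin.castLE (by norm_num) (i + 2))

/-- The graph `T_v`: the complete frame on `t₁,…,t₄` together with the images of the three
copies of the wheel graph `W_v` under the copy maps. -/
def TGraph {V : Type*} [DecidableEq V] (h₁ h₂ h₃ : V) (v : V) (s : List V) :
    SimpleGraph (TVert V h₁ h₂ h₃) :=
  SimpleGraph.fromRel (fun a b =>
    (∃ x y : Fin 4, a = Sum.inl x ∧ b = Sum.inl y) ∨
    (∃ (i : Fin 3) (u w : V), (wheelGraph v s).Adj u w ∧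
      a = copyMap h₁ h₂ h₃ i u ∧ b = copyMap h₁ h₂ h₃ i w))

/-- `φ` induces a plane straight-line drawing of `G`: `φ` is injective, any two distinct
edges intersect exactly in the images of their common endpoints, and no vertex image lies
on the closed segment of an edge not containing that vertex. -/
def IsPlaneDrawing {U : Type*} (G : SimpleGraph U) (φ : U → ℝ × ℝ) : Prop :=
  Function.Injective φ ∧
  (∀ a b c d : U, G.Adj a b → G.Adj c d → s(a, b) ≠ s(c, d) →
    segment ℝ (φ a) (φ b) ∩ segment ℝ (φ c) (φ d) =
      φ '' (({a, b} : Set U) ∩ {c, d})) ∧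
  (∀ a b x : U, G.Adj a b → x ≠ a → x ≠ b → φ x ∉ segment ℝ (φ a) (φ b))

/-- `f` realizes the order type `χ` by points in the plane. -/
def Realizes {V : Type*} (χ : V → V → V → ℤ) (f : V → ℝ × ℝ) : Prop :=
  Function.Injective f ∧
  ∀ a b c : V, a ≠ b → a ≠ c → b ≠ c →
    χ a b c = (SignType.sign (det2 (f c - f a) (f b - f a)) : ℤ)

/-- `G` is 3-connected: removing any at most two vertices leaves a connected graph. -/
def ThreeConnected {U : Type*} (G : SimpleGraph U) : Prop :=
  ∀ S : Set U, S.ncard ≤ 2 → (G.induce Sᶜ).Connected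

/-- The wheel graph with rim of length `n`: rim vertices `Fin n` consecutively adjacent
(mod `n`) and a hub adjacent to every rim vertex. -/
def wheel (n : ℕ) : SimpleGraph (Fin n ⊕ Unit) :=
  SimpleGraph.fromRel (fun a b =>
    (∃ i j : Fin n, (j : ℕ) = ((i : ℕ) + 1) % n ∧ a = Sum.inl i ∧ b = Sum.inl j) ∨
    (∃ i : Fin n, a = Sum.inr () ∧ b = Sum.inl i))

/-- No three points of `P` are collinear. -/
def NoThreeCollinear (P : Set (ℝ × ℝ)) : Prop :=
  ∀ a ∈ P, ∀ b ∈ P, ∀ c ∈ P, a ≠ b → a ≠ c → b ≠ c → det2 (b - a) (c - a) ≠ 0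

/-- `q` is a counterclockwise radial order of `P \ {p}` around `p`. -/
def CCWRadialOrder (P : Set (ℝ × ℝ)) (p : ℝ × ℝ) (q : List (ℝ × ℝ)) : Prop :=
  q.Nodup ∧ (∀ x : ℝ × ℝ, x ∈ q ↔ x ∈ P \ {p}) ∧
  ∀ j : ℕ, j < q.length →
    0 < det2 (q.getD j p - p) (q.getD ((j + 1) % q.length) p - p) ∧
    ∀ r ∈ P, r ≠ p → r ≠ q.getD j p → r ≠ q.getD ((j + 1) % q.length) p →
      ¬(0 < det2 (q.getD j p - p) (r - p) ∧
        0 < det2 (r - p) (q.getD ((j + 1) % q.length) p - p))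

/-- The edges (as ordered pairs of endpoints) of the straight-line drawing of the wheel
with hub `p` and rim cycle `q`: the spokes `(p, qⱼ)` and the rim edges `(qⱼ, q_{j+1})`,
indices mod the length of `q`. -/
def wheelEdgePairs (p : ℝ × ℝ) (q : List (ℝ × ℝ)) : Set ((ℝ × ℝ) × (ℝ × ℝ)) :=
  {e | ∃ j : ℕ, j < q.length ∧
    (e = (p, q.getD j p) ∨ e = (q.getD j p, q.getD ((j + 1) % q.length) p))}

/-- The straight-line drawing of the wheel with hub `p` and rim cycle `q` is plane: any two
distinct segments among the spokes and rim edges intersect exactly in their common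
endpoints. -/
def WheelDrawingPlane (p : ℝ × ℝ) (q : List (ℝ × ℝ)) : Prop :=
  ∀ e₁ ∈ wheelEdgePairs p q, ∀ e₂ ∈ wheelEdgePairs p q,
    s(e₁.1, e₁.2) ≠ s(e₂.1, e₂.2) →
    segment ℝ e₁.1 e₁.2 ∩ segment ℝ e₂.1 e₂.2 =
      ({e₁.1, e₁.2} : Set (ℝ × ℝ)) ∩ {e₂.1, e₂.2}

namespace IsOrderType

variable {V : Type*} {χ : V → V → V → ℤ}

lemma eq_one_or_neg_one (hχ : IsOrderType χ) {a b c : V} (hab : a ≠ b) (hac : a ≠ c)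
    (hbc : b ≠ c) : χ a b c = 1 ∨ χ a b c = -1 :=
  hχ.1 a b c hab hac hbc

lemma swap_outer (hχ : IsOrderType χ) (a b c : V) : χ c b a = -χ a b c := by
  obtain ⟨-, -, h₁, h₂, -⟩ := hχ
  rw [h₁ b c a, h₂ b a c, h₁ a b c, neg_neg]

lemma ne_of_eq_one (hχ : IsOrderType χ) {a b c : V} (h : χ a b c = 1) :
    a ≠ b ∧ a ≠ c ∧ b ≠ c := by
  have h0 := hχ.2.1 a b c
  grind

/-- The Grassmann–Plücker axiom with the common element in the middle position. -/
lemma grassmann_plucker_middle (hχ : IsOrderType χ) {x a b c d : V}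
    (hxa : x ≠ a) (hxb : x ≠ b) (hxc : x ≠ c) (hxd : x ≠ d) (hab : a ≠ b) (hac : a ≠ c)
    (had : a ≠ d) (hbc : b ≠ c) (hbd : b ≠ d) (hcd : c ≠ d) :
    (χ a x b * χ c x d = -1 ∨ -(χ a x c * χ b x d) = -1 ∨ χ a x d * χ b x c = -1) ∧
    (χ a x b * χ c x d = 1 ∨ -(χ a x c * χ b x d) = 1 ∨ χ a x d * χ b x c = 1) := by
  obtain ⟨-, -, h₁, -, h⟩ := hχ
  have := h x a b c d hxa hxb hxc hxd hab hac had hbc hbd hcd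
  simpa only [h₁ a x, h₁ b x, h₁ c x, neg_mul_neg] using this

/-- The elements on one side of the line through `x` and `e` are linearly
ordered by `χ · x ·`. -/
lemma trans_of_same_side (hχ : IsOrderType χ) {x e a b c : V} (hea : χ e x a = χ e x b)
    (hec : χ e x b = χ e x c) (hex : e ≠ x) (hae : a ≠ e) (hbe : b ≠ e) (hce : c ≠ e)
    (hab : χ a x b = 1) (hbc : χ b x c = 1) : χ a x c = 1 := by
  have hab' := hχ.ne_of_eq_one hab
  have hbc' := hχ.ne_of_eq_one hbc
  have hac : a ≠ c := by
    rintro rfl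
    have := hχ.swap_outer a x b
    omega
  have hs := hχ.eq_one_or_neg_one hab'.1 hac hbc'.2.2
  have he := hχ.eq_one_or_neg_one hex hae.symm hab'.1.symm
  have gp := hχ.grassmann_plucker_middle hex.symm hab'.1.symm hbc'.1.symm hbc'.2.2
    hae.symm hbe.symm hce.symm hab'.2.1 hac hbc'.2.1
  rw [← hec, ← hea, hab, hbc] at gp
  rcases hs with hs | hs
  · exact hs
  · rcases he with he | he <;> rw [he, hs] at gp <;> norm_num at gp

end IsOrderType

/-- The distinct elements `a`, `b`, `c` occur in this cyclic order around `v`. -/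
def IsCyclicAround {V : Type*} (χ : V → V → V → ℤ) (v a b c : V) : Prop :=
  χ a v b = 1 ∧ χ b v c = 1 ∨ χ b v c = 1 ∧ χ c v a = 1 ∨ χ c v a = 1 ∧ χ a v b = 1

lemma IsCyclicAround.rotate {V : Type*} {χ : V → V → V → ℤ} {v a b c : V}
    (h : IsCyclicAround χ v a b c) : IsCyclicAround χ v c a b := by
  unfold IsCyclicAround at *
  tauto

/-- `a` comes before `b` in the sweep around `v` starting at `e`. -/
def SweepBefore {V : Type*} (χ : V → V → V → ℤ) (v e a b : V) : Prop :=
  (a ≠ v ∧ a ≠ e ∧ b ≠ v ∧ b ≠ e) ∧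
    (χ e v a = χ e v b ∧ χ a v b = 1 ∨ χ e v a = 1 ∧ χ e v b = -1)

namespace SweepBefore

variable {V : Type*} {χ : V → V → V → ℤ} {v e a b c : V}

lemma trans (hχ : IsOrderType χ) (hev : e ≠ v) (hab : SweepBefore χ v e a b)
    (hbc : SweepBefore χ v e b c) : SweepBefore χ v e a c := by
  obtain ⟨⟨hav, hae, hbv, hbe⟩, hab⟩ := hab
  obtain ⟨⟨-, -, hcv, hce⟩, hbc⟩ := hbc
  refine ⟨⟨hav, hae, hcv, hce⟩, ?_⟩
  rcases hab with ⟨h₁, h₂⟩ | ⟨h₁, h₂⟩ <;> rcases hbc with ⟨h₃, h₄⟩ | ⟨h₃, h₄⟩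
  · exact .inl ⟨h₁.trans h₃, hχ.trans_of_same_side h₁ h₃ hev hae hbe hce h₂ h₄⟩
  · exact .inr ⟨h₁.trans h₃, h₄⟩
  · exact .inr ⟨h₁, h₃.symm.trans h₂⟩
  · exact .inr ⟨h₁, h₄⟩

lemma isCyclicAround_start (hχ : IsOrderType χ) (hev : e ≠ v) (hab : SweepBefore χ v e a b) :
    IsCyclicAround χ v e a b := by
  obtain ⟨⟨hav, hae, hbv, hbe⟩, hab⟩ := hab
  have h₁ := hχ.eq_one_or_neg_one hev hae.symm hav.symm
  have h₂ := hχ.swap_outer e v b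
  unfold IsCyclicAround
  omega

lemma isCyclicAround (hχ : IsOrderType χ) (hev : e ≠ v) (hab : SweepBefore χ v e a b)
    (hbc : SweepBefore χ v e b c) (hac : SweepBefore χ v e a c) :
    IsCyclicAround χ v a b c := by
  have ne : ∀ {x y}, SweepBefore χ v e x y → x ≠ y := by
    rintro x y ⟨-, h⟩ rfl
    have := hχ.2.1 x v x (by simp)
    omega
  have nab := ne hab
  have nbc := ne hbc
  have nac := ne hac
  obtain ⟨⟨hav, hae, hbv, hbe⟩, hab⟩ := hab
  obtain ⟨⟨-, -, hcv, hce⟩, hbc⟩ := hbc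
  have gp := hχ.grassmann_plucker_middle hev.symm hav.symm hbv.symm hcv.symm
    hae.symm hbe.symm hce.symm nab nac nbc
  have sab := hχ.eq_one_or_neg_one hav nab hbv.symm
  have sbc := hχ.eq_one_or_neg_one hbv nbc hcv.symm
  have sac := hχ.eq_one_or_neg_one hav nac hcv.symm
  have swap := hχ.swap_outer a v c
  unfold IsCyclicAround
  rcases hab with ⟨h₁, h₂⟩ | ⟨h₁, h₂⟩ <;> rcases hbc with ⟨h₃, h₄⟩ | ⟨h₃, h₄⟩
  · exact .inl ⟨h₂, h₄⟩
  · rw [h₁, h₃, h₄, h₂] at gp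
    omega
  · rw [← h₃, h₁, h₂, h₄] at gp
    omega
  · omega

end SweepBefore

lemma forall_isCyclicAround_rotate {V : Type*} {χ : V → V → V → ℤ} {v : V} (k : ℕ)
    {s : List V} (hs : ∀ a b c, [a, b, c].Sublist s → IsCyclicAround χ v a b c) :
    ∀ a b c, [a, b, c].Sublist (s.rotate k) → IsCyclicAround χ v a b c := by
  induction k generalizing s with
  | zero => simpa using hs
  | succ k ih =>
    cases s with
    | nil => simp
    | cons x l =>
      rw [List.rotate_cons_succ]
      refine ih fun a b c habc => ?_
      rcases List.sublist_append_iff.1 habc with ⟨l₁, l₂, he, h₁, h₂⟩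
      rcases List.sublist_singleton.1 h₂ with rfl | rfl
      · rw [List.append_nil] at he
        exact hs a b c (he ▸ h₁.cons x)
      · obtain ⟨rfl, rfl⟩ : l₁ = [a, b] ∧ c = x := by
          have := List.append_inj' (s₁ := [a, b]) (t₁ := [c]) he rfl
          exact ⟨this.1.symm, by simpa using this.2⟩
        exact (hs c a b (h₁.cons_cons c)).rotate.rotate

/-- Every internal surrounding sequence winds around `v` exactly once. -/
lemma IsInternalSurroundSeq.isCyclicAround {V : Type*} {χ : V → V → V → ℤ}
    (hχ : IsOrderType χ) {v : V} {s : List V} (hs : IsInternalSurroundSeq χ v s)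
    {a b c : V} (habc : [a, b, c].Sublist s) : IsCyclicAround χ v a b c := by
  obtain ⟨hnd, hmem, hchain, -, p, ⟨-, -, hpos, hneg⟩, -⟩ := hs
  cases s with
  | nil => simp at habc
  | cons e t =>
    have hev : e ≠ v := (hmem e).1 (by simp)
    have ht : ∀ x ∈ t, x ≠ v ∧ x ≠ e := fun x hx =>
      ⟨(hmem x).1 (by simp [hx]), fun h => (List.nodup_cons.1 hnd).1 (h ▸ hx)⟩
    have hsweep : t.Pairwise (SweepBefore χ v e) := by
      have : IsTrans V (SweepBefore χ v e) := ⟨fun _ _ _ h h' => h.trans hχ hev h'⟩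
      refine List.isChain_iff_pairwise.1 (List.isChain_iff_getElem.2 fun i hi => ?_)
      have hi' : i < t.length := by omega
      have h₁ := ht _ (List.getElem_mem hi')
      have h₂ := ht _ (List.getElem_mem hi)
      refine ⟨⟨h₁.1, h₁.2, h₂.1, h₂.2⟩, ?_⟩
      have hstep := List.isChain_iff_getElem.1 hchain (i + 1) (by simpa using hi)
      have p₁ := hpos (i + 1)
      have p₂ := hpos (i + 2)
      have n₁ := hneg (i + 1)
      have n₂ := hneg (i + 2)
      simp only [List.getD_cons_zero, List.getD_cons_succ, List.length_cons,
        List.getD_eq_getElem _ _ hi, List.getD_eq_getElem _ _ hi', List.getElem_cons_succ]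
        at p₁ p₂ n₁ n₂ hstep
      rcases lt_trichotomy p (i + 1) with hp | hp | hp
      · exact .inl ⟨by rw [n₁ hp (by omega), n₂ (by omega) (by omega)], hstep⟩
      · exact .inr ⟨p₁ (by omega) hp.ge, n₂ (by omega) (by omega)⟩
      · exact .inl ⟨by rw [p₁ (by omega) (by omega), p₂ (by omega) (by omega)], hstep⟩
    rcases List.sublist_cons_iff.1 habc with h | ⟨r, hr, h⟩
    · have := hsweep.sublist h
      simp only [List.pairwise_cons, List.mem_cons, List.not_mem_nil] at this
      exact (this.1 b (by simp)).isCyclicAround hχ hev (this.2.1 c (by simp))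
        (this.1 c (by simp))
    · obtain ⟨rfl, rfl⟩ := List.cons.inj hr
      have := hsweep.sublist h
      simp only [List.pairwise_cons, List.mem_cons, List.not_mem_nil] at this
      exact (this.1 c (by simp)).isCyclicAround_start hχ hev

lemma IsHullElement.exists_hull_edge {V : Type*} {χ : V → V → V → ℤ} {h : V}
    (hh : IsHullElement χ h) : ∃ e, e ≠ h ∧ ∀ x, x ≠ h → x ≠ e → χ h e x = 1 := by
  obtain ⟨t, f, ⟨ht, hinj, hf⟩, i, rfl⟩ := hh
  have : Fact (1 < t) := ⟨by omega⟩
  exact ⟨f (i + 1), fun he => by simpa using hinj he, hf i⟩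

/-- A hull surrounding sequence of `h` is linearly ordered by `χ · h ·`. -/
lemma IsHullSurroundSeq.pairwise {V : Type*} {χ : V → V → V → ℤ} (hχ : IsOrderType χ)
    {h : V} (hh : IsHullElement χ h) {s : List V} (hs : IsHullSurroundSeq χ h s) :
    s.Pairwise fun a b => χ a h b = 1 := by
  obtain ⟨e, heh, he⟩ := hh.exists_hull_edge
  have hneg : ∀ x, x ≠ h → x ≠ e → χ e h x = -1 := fun x hx hxe => by
    rw [hχ.2.2.1, he x hx hxe]
  have : IsTrans V fun a b => χ a h b = 1 := ⟨fun a b c hab hbc => by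
    have hab' := hχ.ne_of_eq_one hab
    have hbc' := hχ.ne_of_eq_one hbc
    have hae : a ≠ e := by
      rintro rfl
      have := hneg b hbc'.1 hab'.2.1.symm
      omega
    have hbe : b ≠ e := by
      rintro rfl
      have := hneg c hbc'.2.2.symm hbc'.2.1.symm
      omega
    by_cases hce : c = e
    · rw [hce, hχ.swap_outer, hneg a hab'.1 hae, neg_neg]
    · exact hχ.trans_of_same_side ((hneg a hab'.1 hae).trans (hneg b hbc'.1 hbe).symm)
        ((hneg b hbc'.1 hbe).trans (hneg c hbc'.2.2.symm hce).symm) heh hae hbe hce hab hbc⟩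
  exact List.isChain_iff_pairwise.1 hs.2.2

lemma List.pair_sublist_or {α : Type*} {a b : α} {l : List α} (ha : a ∈ l) (hb : b ∈ l)
    (hab : a ≠ b) : [a, b].Sublist l ∨ [b, a].Sublist l := by
  induction l with
  | nil => simp at ha
  | cons x l ih =>
    rcases List.mem_cons.1 ha with rfl | ha' <;> rcases List.mem_cons.1 hb with rfl | hb'
    · exact absurd rfl hab
    · exact .inl ((List.singleton_sublist.2 hb').cons_cons a)
    · exact .inr ((List.singleton_sublist.2 ha').cons_cons b)
    · exact (ih ha' hb').imp (·.cons x) (·.cons x)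

theorem chi_internal_iff_before {V : Type*} [Fintype V] [DecidableEq V]
    (χ : V → V → V → ℤ) (hn : 4 ≤ Fintype.card V) (hχ : IsOrderType χ)
    (u v w : V) (huv : u ≠ v) (huw : u ≠ w) (hvw : v ≠ w)
    (hu : ¬IsHullElement χ u) (hv : ¬IsHullElement χ v) (hw : ¬IsHullElement χ w)
    (h : V) (hh : IsHullElement χ h)
    (sh : List V) (hsh : IsHullSurroundSeq χ h sh)
    (hub : [u, v].Sublist sh) (hwb : [w, v].Sublist sh)
    (s ws : List V) (hint : IsInternalSurroundSeq χ v s)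
    (k : ℕ) (hrot : ws = s.rotate k) (hhead : ws.head? = some h) :
    χ u v w = 1 ↔ [u, w].Sublist ws := by
  have hcyc := forall_isCyclicAround_rotate k fun _ _ _ => hint.isCyclicAround hχ
  have hmem : ∀ x, x ∈ ws ↔ x ≠ v := fun x => by rw [hrot, List.mem_rotate, hint.2.1]
  rw [← hrot] at hcyc
  obtain ⟨t, rfl⟩ := List.head?_eq_some_iff.1 hhead
  have hpair := hsh.pairwise hχ hh
  have huhv : χ u h v = 1 := by simpa using hpair.sublist hub
  have hwhv : χ w h v = 1 := by simpa using hpair.sublist hwb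
  have hflip : ∀ x, χ x h v = 1 → χ h v x = 1 ∧ χ x v h = -1 := fun x hx => by
    have h₁ := hχ.2.2.2.1 x h v
    have h₂ := hχ.swap_outer x v h
    omega
  have key : ∀ a b, χ a h v = 1 → χ b h v = 1 → [a, b].Sublist t → χ a v b = 1 := by
    intro a b ha hb hab
    have hc := hcyc h a b (hab.cons_cons h)
    have := hflip b hb
    unfold IsCyclicAround at hc
    omega
  have hut : u ∈ t :=
    ((List.mem_cons.1 ((hmem u).2 huv)).resolve_left (hχ.ne_of_eq_one huhv).1)
  have hwt : w ∈ t :=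
    ((List.mem_cons.1 ((hmem w).2 hvw.symm)).resolve_left (hχ.ne_of_eq_one hwhv).1)
  constructor
  · intro h1
    rcases List.pair_sublist_or hut hwt huw with hs | hs
    · exact hs.cons h
    · have h₁ := key w u hwhv huhv hs
      have h₂ := hχ.swap_outer u v w
      omega
  · intro hs
    rcases List.sublist_cons_iff.1 hs with hs | ⟨r, hr, -⟩
    · exact key u w huhv hwhv hs
    · exact absurd (List.cons.inj hr).1 (hχ.ne_of_eq_one huhv).1
end

section
/- Let n ≥ 3 and let W be the wheel graph with rim of length n. For every vertex u of W and every three pairwise distinct rim vertices h_1, h_2, h_3, there exist walks P_1, P_2, P_3 in W from u to h_1, h_2, h_3 respectively, each visiting no vertex twice, such that any two of them have no vertex in common other than u. -/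
/-- A sequence of consecutively adjacent vertices yields a path through some of its terms. -/
theorem SimpleGraph.exists_isPath_of_adj_succ {V : Type*} (G : SimpleGraph V) (v : ℕ → V)
    (k : ℕ) (hv : ∀ i < k, G.Adj (v i) (v (i + 1))) :
    ∃ P : G.Walk (v 0) (v k), P.IsPath ∧ ∀ x ∈ P.support, ∃ j ≤ k, x = v j := by
  classical
  suffices h : ∃ P : G.Walk (v 0) (v k), ∀ x ∈ P.support, ∃ j ≤ k, x = v j by
    obtain ⟨P, hP⟩ := h
    exact ⟨P.bypass, P.bypass_isPath, fun x hx => hP x (P.support_bypass_subset_support hx)⟩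
  induction k with
  | zero => exact ⟨.nil, fun x hx => ⟨0, le_rfl, by simpa using hx⟩⟩
  | succ k ih =>
    obtain ⟨P, hP⟩ := ih fun i hi => hv i (by omega)
    refine ⟨P.concat (hv k (by omega)), fun x hx => ?_⟩
    rw [SimpleGraph.Walk.support_concat, List.mem_append, List.mem_singleton] at hx
    rcases hx with hx | rfl
    · obtain ⟨j, hj, rfl⟩ := hP x hx
      exact ⟨j, by omega, rfl⟩
    · exact ⟨k + 1, le_rfl, rfl⟩

theorem wheel_adj_hub (n : ℕ) (i : Fin n) : (wheel n).Adj (Sum.inr ()) (Sum.inl i) := by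
  simp [wheel]

theorem wheel_adj_rim {n : ℕ} (hn : 2 ≤ n) {i j : Fin n} (h : (j : ℕ) = ((i : ℕ) + 1) % n) :
    (wheel n).Adj (Sum.inl i) (Sum.inl j) := by
  rw [wheel, SimpleGraph.fromRel_adj]
  refine ⟨fun hij => ?_, Or.inl (Or.inl ⟨i, j, h, rfl, rfl⟩)⟩
  obtain rfl := Sum.inl.inj hij
  rcases Nat.lt_or_ge ((i : ℕ) + 1) n with hi | hi
  · rw [Nat.mod_eq_of_lt hi] at h
    omega
  · have : (i : ℕ) + 1 = n := by omega
    rw [this, Nat.mod_self] at h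
    omega

/-- The rim vertex reached from `u` after `k` steps forward. -/
def rimShift {n : ℕ} (u : Fin n) (k : ℕ) : Fin n :=
  ⟨((u : ℕ) + k) % n, Nat.mod_lt _ u.pos⟩

theorem rimShift_zero {n : ℕ} (u : Fin n) : rimShift u 0 = u :=
  Fin.ext (Nat.mod_eq_of_lt u.isLt)

theorem rimShift_self {n : ℕ} (u : Fin n) : rimShift u n = u :=
  Fin.ext (by simp [rimShift, Nat.mod_eq_of_lt u.isLt])

theorem rimShift_injOn {n : ℕ} (u : Fin n) : Set.InjOn (rimShift u) (Set.Iio n) := by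
  intro i hi j hj h
  have h' : (u : ℕ) + i ≡ u + j [MOD n] := congrArg Fin.val h
  exact (Nat.ModEq.add_left_cancel' _ h').eq_of_lt_of_lt hi hj

theorem exists_rimShift_eq {n : ℕ} (u h : Fin n) : ∃ k < n, rimShift u k = h := by
  have hu := u.isLt
  have hh := h.isLt
  rcases le_or_gt u h with hle | hlt
  · refine ⟨h - u, by omega, Fin.ext ?_⟩
    change ((u : ℕ) + (h - u)) % n = h
    rw [Nat.add_sub_cancel' hle, Nat.mod_eq_of_lt hh]
  · refine ⟨h + n - u, by omega, Fin.ext ?_⟩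
    change ((u : ℕ) + (h + n - u)) % n = h
    rw [Nat.add_sub_cancel' (by omega), Nat.add_mod_right, Nat.mod_eq_of_lt hh]

theorem wheel_adj_rimShift {n : ℕ} (hn : 2 ≤ n) (u : Fin n) (k : ℕ) :
    (wheel n).Adj (Sum.inl (rimShift u k)) (Sum.inl (rimShift u (k + 1))) :=
  wheel_adj_rim hn (by simp [rimShift, add_assoc])

theorem wheel_exists_forward_path {n : ℕ} (hn : 2 ≤ n) (u : Fin n) (k : ℕ) :
    ∃ P : (wheel n).Walk (Sum.inl u) (Sum.inl (rimShift u k)),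
      P.IsPath ∧ ∀ x ∈ P.support, ∃ j ≤ k, x = Sum.inl (rimShift u j) := by
  obtain ⟨P, hP, hs⟩ := (wheel n).exists_isPath_of_adj_succ
    (fun j => Sum.inl (rimShift u j)) k fun i _ => wheel_adj_rimShift hn u i
  exact ⟨P.copy (by simp [rimShift_zero]) rfl, by simpa using hP, by simpa using hs⟩

theorem wheel_exists_backward_path {n : ℕ} (hn : 2 ≤ n) (u : Fin n) {k : ℕ} (hk : k ≤ n) :
    ∃ P : (wheel n).Walk (Sum.inl u) (Sum.inl (rimShift u k)),
      P.IsPath ∧ ∀ x ∈ P.support, ∃ j, k ≤ j ∧ j ≤ n ∧ x = Sum.inl (rimShift u j) := by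
  obtain ⟨P, hP, hs⟩ := (wheel n).exists_isPath_of_adj_succ
    (fun j => Sum.inl (rimShift u (n - j))) (n - k) fun i hi => by
      have h := wheel_adj_rimShift hn u (n - (i + 1))
      rw [show n - (i + 1) + 1 = n - i by omega] at h
      exact h.symm
  refine ⟨P.copy (by simp [rimShift_self]) (by simp [Nat.sub_sub_self hk]), by simpa using hP,
    fun x hx => ?_⟩
  obtain ⟨j, hj, rfl⟩ := hs x (by simpa using hx)
  exact ⟨n - j, by omega, by omega, rfl⟩

/-- From a rim vertex, one can go forward to the first, through the hub to the second and
backward to the third of three rim vertices met in this order. -/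
theorem wheel_three_disjoint_paths_of_lt {n : ℕ} (hn : 2 ≤ n) (u : Fin n) {a b c : ℕ}
    (hab : a < b) (hbc : b < c) (hc : c < n) :
    ∃ (P₁ : (wheel n).Walk (Sum.inl u) (Sum.inl (rimShift u a)))
      (P₂ : (wheel n).Walk (Sum.inl u) (Sum.inl (rimShift u b)))
      (P₃ : (wheel n).Walk (Sum.inl u) (Sum.inl (rimShift u c))),
      P₁.support.Nodup ∧ P₂.support.Nodup ∧ P₃.support.Nodup ∧
      (∀ x, x ∈ P₁.support → x ∈ P₂.support → x = Sum.inl u) ∧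
      (∀ x, x ∈ P₁.support → x ∈ P₃.support → x = Sum.inl u) ∧
      (∀ x, x ∈ P₂.support → x ∈ P₃.support → x = Sum.inl u) := by
  obtain ⟨P₁, hP₁, hs₁⟩ := wheel_exists_forward_path hn u a
  obtain ⟨P₃, hP₃, hs₃⟩ := wheel_exists_backward_path hn u hc.le
  let P₂ : (wheel n).Walk (Sum.inl u) (Sum.inl (rimShift u b)) :=
    .cons (wheel_adj_hub n u).symm (.cons (wheel_adj_hub n _) .nil)
  have hs₂ : P₂.support = [Sum.inl u, Sum.inr (), Sum.inl (rimShift u b)] := rfl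
  have hub : u ≠ rimShift u b := fun h => by
    have := rimShift_injOn u (show 0 < n by omega) (show b < n by omega)
      ((rimShift_zero u).trans h)
    omega
  refine ⟨P₁, P₂, P₃, hP₁.support_nodup, by simp [hs₂, hub], hP₃.support_nodup, ?_, ?_, ?_⟩
  · intro x h₁ h₂
    obtain ⟨j, hj, rfl⟩ := hs₁ x h₁
    simp only [hs₂, List.mem_cons, Sum.inl.injEq, reduceCtorEq, List.not_mem_nil, or_false,
      false_or] at h₂
    rcases h₂ with h | h
    · rw [h]
    · have := rimShift_injOn u (show j < n by omega) (show b < n by omega) h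
      omega
  · intro x h₁ h₃
    obtain ⟨j, hj, rfl⟩ := hs₁ x h₁
    obtain ⟨i, hi, hin, h⟩ := hs₃ _ h₃
    rcases hin.eq_or_lt with rfl | hin
    · rw [h, rimShift_self]
    · have := rimShift_injOn u (show j < n by omega) hin (Sum.inl.inj h)
      omega
  · intro x h₂ h₃
    obtain ⟨j, hj, hjn, rfl⟩ := hs₃ x h₃
    rcases hjn.eq_or_lt with rfl | hjn
    · rw [rimShift_self]
    simp only [hs₂, List.mem_cons, Sum.inl.injEq, reduceCtorEq, List.not_mem_nil, or_false,
      false_or] at h₂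
    rcases h₂ with h | h
    · rw [h]
    · have := rimShift_injOn u hjn (show b < n by omega) h
      omega

theorem wheel_three_disjoint_paths (n : ℕ) (hn : 3 ≤ n)
    (u : Fin n ⊕ Unit) (h₁ h₂ h₃ : Fin n)
    (h12 : h₁ ≠ h₂) (h13 : h₁ ≠ h₃) (h23 : h₂ ≠ h₃) :
    ∃ (P₁ : (wheel n).Walk u (Sum.inl h₁)) (P₂ : (wheel n).Walk u (Sum.inl h₂))
      (P₃ : (wheel n).Walk u (Sum.inl h₃)),
      P₁.support.Nodup ∧ P₂.support.Nodup ∧ P₃.support.Nodup ∧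
      (∀ x, x ∈ P₁.support → x ∈ P₂.support → x = u) ∧
      (∀ x, x ∈ P₁.support → x ∈ P₃.support → x = u) ∧
      (∀ x, x ∈ P₂.support → x ∈ P₃.support → x = u) := by
  rcases u with u | ⟨⟩
  · obtain ⟨a, ha, rfl⟩ := exists_rimShift_eq u h₁
    obtain ⟨b, hb, rfl⟩ := exists_rimShift_eq u h₂
    obtain ⟨c, hc, rfl⟩ := exists_rimShift_eq u h₃
    have hn₂ : 2 ≤ n := by omega
    rcases lt_or_gt_of_ne (ne_of_apply_ne _ h12) with hab | hab <;>
      rcases lt_or_gt_of_ne (ne_of_apply_ne _ h13) with hac | hac <;>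
      rcases lt_or_gt_of_ne (ne_of_apply_ne _ h23) with hbc | hbc
    · exact wheel_three_disjoint_paths_of_lt hn₂ u hab hbc hc
    · obtain ⟨P, Q, R, hP, hQ, hR, hPQ, hPR, hQR⟩ :=
        wheel_three_disjoint_paths_of_lt hn₂ u hac hbc hb
      exact ⟨P, R, Q, hP, hR, hQ, hPR, hPQ, fun x h h' => hQR x h' h⟩
    · omega
    · obtain ⟨P, Q, R, hP, hQ, hR, hPQ, hPR, hQR⟩ :=
        wheel_three_disjoint_paths_of_lt hn₂ u hac hab hb
      exact ⟨Q, R, P, hQ, hR, hP, hQR, fun x h h' => hPQ x h' h, fun x h h' => hPR x h' h⟩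
    · obtain ⟨P, Q, R, hP, hQ, hR, hPQ, hPR, hQR⟩ :=
        wheel_three_disjoint_paths_of_lt hn₂ u hab hac hc
      exact ⟨Q, P, R, hQ, hP, hR, fun x h h' => hPQ x h' h, hQR, hPR⟩
    · omega
    · obtain ⟨P, Q, R, hP, hQ, hR, hPQ, hPR, hQR⟩ :=
        wheel_three_disjoint_paths_of_lt hn₂ u hbc hac ha
      exact ⟨R, P, Q, hR, hP, hQ, fun x h h' => hPR x h' h, fun x h h' => hQR x h' h, hPQ⟩
    · obtain ⟨P, Q, R, hP, hQ, hR, hPQ, hPR, hQR⟩ :=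
        wheel_three_disjoint_paths_of_lt hn₂ u hbc hab ha
      exact ⟨R, Q, P, hR, hQ, hP, fun x h h' => hQR x h' h, fun x h h' => hPR x h' h,
        fun x h h' => hPQ x h' h⟩
  · refine ⟨(wheel_adj_hub n h₁).toWalk, (wheel_adj_hub n h₂).toWalk,
      (wheel_adj_hub n h₃).toWalk, ?_⟩
    simp [h12, h13, h23]
end

section
/- Let χ be an order type in general position on a finite set V with |V| = n ≥ 4, realized by an injective map f : V → ℝ². Let v be a non-hull element of χ and let v_1, …, v_{n−1} be an internal surrounding sequence of v. Then f(v_1), …, f(v_{n−1}) is a counterclockwise radial order of f(V) ∖ {f(v)} around f(v). -/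
theorem det2_swap (x y : ℝ × ℝ) : det2 y x = -det2 x y := by
  unfold det2; ring

theorem det2_neg_left (x y : ℝ × ℝ) : det2 (-x) y = -det2 x y := by
  simp only [det2, Prod.fst_neg, Prod.snd_neg]; ring

theorem det2_plucker (o x y z : ℝ × ℝ) :
    det2 o y * det2 x z = det2 o x * det2 y z + det2 o z * det2 x y := by
  unfold det2; ring

/-- On the open half-plane to the left of `o`, being counterclockwise is transitive. -/
theorem det2_pos_trans {o x y z : ℝ × ℝ} (hx : 0 < det2 o x) (hy : 0 < det2 o y)
    (hz : 0 < det2 o z) (hxy : 0 < det2 x y) (hyz : 0 < det2 y z) : 0 < det2 x z := by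
  have h : 0 < det2 o y * det2 x z := by
    rw [det2_plucker]; positivity
  exact (mul_pos_iff_of_pos_left hy).1 h

/-- A consecutively counterclockwise sequence in an open half-plane is increasing. -/
theorem det2_pos_of_consecutive {o : ℝ × ℝ} {w : ℕ → ℝ × ℝ} {a b : ℕ}
    (ho : ∀ i, a ≤ i → i ≤ b → 0 < det2 o (w i))
    (hw : ∀ i, a ≤ i → i < b → 0 < det2 (w i) (w (i + 1)))
    {i j : ℕ} (hi : a ≤ i) (hij : i < j) (hj : j ≤ b) : 0 < det2 (w i) (w j) := by
  induction j, hij using Nat.le_induction with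
  | base => exact hw i hi hj
  | succ j hij ih =>
    exact det2_pos_trans (ho i hi (by omega)) (ho j (by omega) (by omega)) (ho _ (by omega) hj)
      (ih (by omega)) (hw j (by omega) (by omega))

/-- If a cyclic sequence of vectors turns counterclockwise at each step and crosses the line
through its first vector only once, then no vector lies strictly inside a consecutive angle. -/
theorem not_between_of_single_sign_change {w : ℕ → ℝ × ℝ} {m p : ℕ} (hp : 0 < p) (hpm : p + 1 < m)
    (hw : ∀ i, i + 1 < m → 0 < det2 (w i) (w (i + 1)))
    (hpos : ∀ j, 0 < j → j ≤ p → 0 < det2 (w 0) (w j))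
    (hneg : ∀ j, p < j → j < m → det2 (w 0) (w j) < 0)
    {j k : ℕ} (hj : j < m) (hk : k < m) (hkj : k ≠ j) (hkj' : k ≠ (j + 1) % m) :
    ¬(0 < det2 (w j) (w k) ∧ 0 < det2 (w k) (w ((j + 1) % m))) := by
  rintro ⟨h₁, h₂⟩
  have left : ∀ {i j}, 1 ≤ i → i < j → j ≤ p → 0 < det2 (w i) (w j) := fun hi hij hj =>
    det2_pos_of_consecutive (a := 1) (b := p) (fun i h h' => hpos i h h')
      (fun i _ _ => hw i (by omega)) hi hij hj
  have right : ∀ {i j}, p + 1 ≤ i → i < j → j ≤ m - 1 → 0 < det2 (w i) (w j) := fun hi hij hj =>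
    det2_pos_of_consecutive (o := -w 0) (a := p + 1) (b := m - 1)
      (fun i h h' => by rw [det2_neg_left]; linarith [hneg i (by omega) (by omega)])
      (fun i _ _ => hw i (by omega)) hi hij hj
  have asymm : ∀ {i j}, 0 < det2 (w i) (w j) → ¬0 < det2 (w j) (w i) := fun {i j} h h' => by
    rw [det2_swap] at h'; linarith
  have zero_pos : ∀ {i}, i < m → 0 < det2 (w 0) (w i) → 0 < i ∧ i ≤ p := fun {i} hi h => by
    refine ⟨Nat.pos_of_ne_zero ?_, ?_⟩
    · rintro rfl; exact asymm h h
    · by_contra hip; linarith [hneg i (by omega) hi]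
  have pos_zero : ∀ {i}, i < m → 0 < det2 (w i) (w 0) → p < i := fun {i} hi h => by
    by_contra hip
    rcases Nat.eq_zero_or_pos i with rfl | hi0
    · exact asymm h h
    · exact asymm h (hpos i hi0 (by omega))
  rcases Nat.lt_or_ge (j + 1) m with hjm | hjm
  swap
  · obtain rfl : m = j + 1 := by omega
    rw [Nat.mod_self] at h₂
    have := pos_zero hk h₂
    exact asymm h₁ (right this (by omega) (by omega))
  rw [Nat.mod_eq_of_lt hjm] at h₂ hkj'
  rcases Nat.eq_zero_or_pos j with rfl | hj0
  · have := zero_pos hk h₁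
    exact asymm h₂ (left (by omega) (by omega) this.2)
  have hplucker := det2_plucker (w 0) (w j) (w k) (w (j + 1))
  have hstep := hw j hjm
  rcases lt_trichotomy j p with hjp | rfl | hjp
  · have hk0 : 0 < det2 (w 0) (w k) := by
      have a := hpos j hj0 hjp.le
      have b := hpos (j + 1) (by omega) hjp
      refine (mul_pos_iff_of_pos_right hstep).1 ?_
      rw [hplucker]; positivity
    have := zero_pos hk hk0
    rcases Nat.lt_or_gt_of_ne hkj with h | h
    · exact asymm h₁ (left (by omega) h (by omega))
    · exact asymm h₂ (left (by omega) (by omega) this.2)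
  · rcases Nat.eq_zero_or_pos k with rfl | hk0
    · exact asymm h₁ (hpos j hj0 le_rfl)
    · rcases Nat.lt_or_gt_of_ne hkj with h | h
      · exact asymm h₁ (left hk0 h le_rfl)
      · exact asymm h₂ (right le_rfl (by omega) (by omega))
  · have hk0 : 0 < det2 (w k) (w 0) := by
      have a := hneg j hjp hj
      have b := hneg (j + 1) (by omega) hjm
      rw [det2_swap (w 0)]
      nlinarith [mul_pos (neg_pos.2 a) h₂, mul_pos (neg_pos.2 b) h₁]
    have := pos_zero hk hk0
    rcases Nat.lt_or_gt_of_ne hkj with h | h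
    · exact asymm h₁ (right this h (by omega))
    · exact asymm h₂ (right (by omega) (by omega) (by omega))

/-- The sign of `χ a v b` is the orientation of `f a, f b` as seen from `f v`. -/
theorem Realizes.eq_sign_det2 {V : Type*} {χ : V → V → V → ℤ} {f : V → ℝ × ℝ}
    (hf : Realizes χ f) {a v b : V} (hav : a ≠ v) (hab : a ≠ b) (hvb : v ≠ b) :
    χ a v b = (SignType.sign (det2 (f a - f v) (f b - f v)) : ℤ) := by
  rw [hf.2 a v b hav hab hvb]
  congr 2
  simp only [det2, Prod.fst_sub, Prod.snd_sub]; ring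

theorem Realizes.det2_pos {V : Type*} {χ : V → V → V → ℤ} {f : V → ℝ × ℝ}
    (hf : Realizes χ f) {a v b : V} (hav : a ≠ v) (hab : a ≠ b) (hvb : v ≠ b)
    (h : χ a v b = 1) : 0 < det2 (f a - f v) (f b - f v) := by
  rw [hf.eq_sign_det2 hav hab hvb] at h
  refine sign_eq_one_iff.1 ?_
  generalize SignType.sign (det2 (f a - f v) (f b - f v)) = e at h ⊢
  revert h; cases e <;> decide

theorem Realizes.det2_neg {V : Type*} {χ : V → V → V → ℤ} {f : V → ℝ × ℝ}
    (hf : Realizes χ f) {a v b : V} (hav : a ≠ v) (hab : a ≠ b) (hvb : v ≠ b)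
    (h : χ a v b = -1) : det2 (f a - f v) (f b - f v) < 0 := by
  rw [hf.eq_sign_det2 hav hab hvb] at h
  refine sign_eq_neg_one_iff.1 ?_
  generalize SignType.sign (det2 (f a - f v) (f b - f v)) = e at h ⊢
  revert h; cases e <;> decide

theorem internal_seq_radial_order {V : Type*} [Fintype V] [DecidableEq V]
    (χ : V → V → V → ℤ) (hn : 4 ≤ Fintype.card V) (hχ : IsOrderType χ)
    (f : V → ℝ × ℝ) (hf : Realizes χ f)
    (v : V) (hv : ¬IsHullElement χ v)
    (s : List V) (hs : IsInternalSurroundSeq χ v s) :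
    CCWRadialOrder (Set.range f) (f v) (s.map f) := by
  obtain ⟨hnd, hmem, hchain, hlast, p, ⟨hp, hpm, hpos, hneg⟩, -⟩ := hs
  have hget : ∀ {i} (hi : i < s.length), s.getD i v = s[i] := fun hi => by simp [hi]
  have hne : ∀ {i}, i < s.length → s.getD i v ≠ v := fun hi => by
    rw [hget hi]; exact (hmem _).1 (List.getElem_mem hi)
  have hinj : ∀ {i j}, i < s.length → j < s.length → i ≠ j → s.getD i v ≠ s.getD j v :=
    fun hi hj hij => by
      rw [hget hi, hget hj]; exact fun h => hij ((hnd.getElem_inj_iff).1 h)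
  have hmap : ∀ i, (s.map f).getD i (f v) = f (s.getD i v) := fun i => List.getD_map ..
  have hstep : ∀ i, i + 1 < s.length →
      0 < det2 (f (s.getD i v) - f v) (f (s.getD (i + 1) v) - f v) := fun i hi => by
    refine hf.det2_pos (hne (by omega)) (hinj (by omega) hi (by omega)) (hne hi).symm ?_
    rw [hget hi, hget (by omega)]
    exact List.isChain_iff_getElem.1 hchain i hi
  refine ⟨hnd.map hf.1, fun x => ?_, fun j hj => ?_⟩
  · simp only [List.mem_map, hmem, Set.mem_sdiff, Set.mem_range, Set.mem_singleton_iff]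
    constructor
    · rintro ⟨a, ha, rfl⟩; exact ⟨⟨a, rfl⟩, hf.1.ne ha⟩
    · rintro ⟨⟨a, rfl⟩, ha⟩; exact ⟨a, fun h => ha (h ▸ rfl), rfl⟩
  rw [List.length_map] at hj ⊢
  rw [hmap, hmap]
  constructor
  · rcases Nat.lt_or_ge (j + 1) s.length with hjm | hjm
    · rw [Nat.mod_eq_of_lt hjm]; exact hstep j hjm
    · have hjl : j = s.length - 1 := by omega
      have h0 : (j + 1) % s.length = 0 := by
        rw [show j + 1 = s.length by omega, Nat.mod_self]
      rw [h0]
      refine hf.det2_pos (hne hj) (hinj hj (by omega) (by omega)) (hne (by omega)).symm ?_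
      refine hlast _ _ ?_ ?_
      · rw [List.getLast?_eq_getElem?, hget hj, ← hjl, List.getElem?_eq_getElem hj]
      · rw [List.head?_eq_getElem?, hget (by omega), List.getElem?_eq_getElem (by omega)]
  · rintro _ ⟨x, rfl⟩ hxv hxj hxj'
    obtain ⟨k, hk, rfl⟩ := List.mem_iff_getElem.1 ((hmem x).2 fun h => hxv (h ▸ rfl))
    rw [← hget hk] at hxj hxj' ⊢
    refine not_between_of_single_sign_change (w := fun i => f (s.getD i v) - f v) hp hpm hstep
      (fun i h h' => ?_) (fun i h h' => ?_) hj hk (fun h => hxj (h ▸ rfl)) (fun h => hxj' (h ▸ rfl))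
    · exact hf.det2_pos (hne (by omega)) (hinj (by omega) (by omega) (by omega))
        (hne (by omega)).symm (hpos i h h')
    · exact hf.det2_neg (hne (by omega)) (hinj (by omega) (by omega) (by omega))
        (hne (by omega)).symm (hneg i h h')
end

section
/- Let χ be an order type in general position on a finite set V with |V| = n ≥ 4 and convex hull sequence h_1, …, h_t. Then for each i, there is exactly one hull surrounding sequence v_1, …, v_{n−1} of h_i; moreover it satisfies v_1 = h_{i−1} and v_{n−1} = h_{i+1} (indices modulo t). -/
namespace IsOrderType

variable {V : Type*} {χ : V → V → V → ℤ}

lemma rotate (hχ : IsOrderType χ) (a b c : V) : χ b c a = χ a b c := by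
  obtain ⟨-, -, hswap, hswap', -⟩ := hχ
  rw [hswap' b a c, hswap a b c, neg_neg]

/-- Around a point `x` whose radial order has a first element `m`, the relation
`χ a x b = 1` is transitive. -/
lemma trans_of_first (hχ : IsOrderType χ) {x m : V} (hm : m ≠ x)
    (hfirst : ∀ v, v ≠ m → v ≠ x → χ m x v = 1) {a b c : V}
    (hab : χ a x b = 1) (hbc : χ b x c = 1) : χ a x c = 1 := by
  obtain ⟨hax, hab', hxb⟩ := hχ.ne_of_eq_one hab
  obtain ⟨-, hbc', hxc⟩ := hχ.ne_of_eq_one hbc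
  have hac : a ≠ c := by
    rintro rfl
    have := hχ.swap_outer a x b
    omega
  have hmin : ∀ {v : V}, v ≠ x → χ v x m ≠ 1 := by
    intro v hv hvm
    have h₁ := hfirst v (hχ.ne_of_eq_one hvm).2.1 hv
    have h₂ := hχ.swap_outer v x m
    omega
  by_cases ham : a = m
  · subst ham
    exact hfirst c hac.symm hxc.symm
  have hbm : b ≠ m := by
    rintro rfl
    exact hmin hax hab
  have hcm : c ≠ m := by
    rintro rfl
    exact hmin hxb.symm hbc
  obtain ⟨hsign, -, hswap, -, hgp⟩ := id hχ
  have h := (hgp x m a b c hm.symm hax.symm hxb hxc (Ne.symm ham) hbm.symm hcm.symm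
    hab' hac hbc').1
  simp only [hswap _ x, hfirst a ham hax, hfirst b hbm hxb.symm, hfirst c hcm hxc.symm,
    hab, hbc] at h
  rcases hsign a x c hax hac hxc with h' | h'
  · exact h'
  · rw [h'] at h
    norm_num at h

end IsOrderType

namespace IsHullSurroundSeq

variable {V : Type*} {χ : V → V → V → ℤ} {x m : V} {s : List V}

lemma pairwise_s12 (hχ : IsOrderType χ) (hm : m ≠ x)
    (hfirst : ∀ v, v ≠ m → v ≠ x → χ m x v = 1) (hs : IsHullSurroundSeq χ x s) :
    s.Pairwise (fun a b => χ a x b = 1) := by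
  have : IsTrans V (fun a b => χ a x b = 1) := ⟨fun _ _ _ => hχ.trans_of_first hm hfirst⟩
  exact List.isChain_iff_pairwise.1 hs.2.2

lemma unique (hχ : IsOrderType χ) (hm : m ≠ x)
    (hfirst : ∀ v, v ≠ m → v ≠ x → χ m x v = 1) {s' : List V}
    (hs : IsHullSurroundSeq χ x s) (hs' : IsHullSurroundSeq χ x s') : s = s' := by
  refine List.Perm.eq_of_pairwise ?_ (hs.pairwise_s12 hχ hm hfirst) (hs'.pairwise_s12 hχ hm hfirst)
    ((List.perm_ext_iff_of_nodup hs.1 hs'.1).2 fun v => (hs.2.1 v).trans (hs'.2.1 v).symm)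
  intro a b _ _ hab hba
  have := hχ.swap_outer a x b
  omega

/-- If the radial order around `x` has a first element, then sorting `V \ {x}` by it gives a
hull surrounding sequence. -/
lemma exists_of_first [Fintype V] [DecidableEq V] (hχ : IsOrderType χ) (hm : m ≠ x)
    (hfirst : ∀ v, v ≠ m → v ≠ x → χ m x v = 1) : ∃ s, IsHullSurroundSeq χ x s := by
  let r : V → V → Prop := fun a b => a = x ∨ (b ≠ x ∧ (a = b ∨ χ a x b = 1))
  have htrans : IsTrans V r := by
    refine ⟨?_⟩
    rintro a b c (rfl | ⟨hb, hab⟩) hbc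
    · exact Or.inl rfl
    · obtain ⟨hc, hbc⟩ := hbc.resolve_left hb
      refine Or.inr ⟨hc, ?_⟩
      rcases hab with rfl | hab
      · exact hbc
      · rcases hbc with rfl | hbc
        · exact Or.inr hab
        · exact Or.inr (hχ.trans_of_first hm hfirst hab hbc)
  have htotal : Std.Total r := by
    refine ⟨fun a b => ?_⟩
    by_cases ha : a = x
    · exact Or.inl (Or.inl ha)
    by_cases hb : b = x
    · exact Or.inr (Or.inl hb)
    by_cases hab : a = b
    · exact Or.inl (Or.inr ⟨hb, Or.inl hab⟩)
    rcases hχ.1 a x b ha hab (Ne.symm hb) with h | h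
    · exact Or.inl (Or.inr ⟨hb, Or.inr h⟩)
    · exact Or.inr (Or.inr ⟨ha, Or.inr (by rw [hχ.swap_outer a x b, h, neg_neg])⟩)
  have hperm := List.perm_insertionSort r (Finset.univ.erase x).toList
  have hnodup := hperm.nodup_iff.2 (Finset.nodup_toList _)
  have hmem : ∀ v, v ∈ List.insertionSort r (Finset.univ.erase x).toList ↔ v ≠ x := by
    intro v
    rw [hperm.mem_iff]
    simp
  refine ⟨_, hnodup, hmem, List.Pairwise.isChain ?_⟩
  refine List.Pairwise.imp_of_mem ?_ ((List.pairwise_insertionSort r _).and hnodup)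
  rintro a b ha - ⟨hr, hne⟩
  exact (((hr.resolve_left ((hmem a).1 ha)).2).resolve_left hne)

lemma head?_eq (hχ : IsOrderType χ) (hm : m ≠ x)
    (hfirst : ∀ v, v ≠ m → v ≠ x → χ m x v = 1) (hs : IsHullSurroundSeq χ x s) :
    s.head? = some m := by
  have hp := hs.pairwise_s12 hχ hm hfirst
  have hmem := (hs.2.1 m).2 hm
  cases s with
  | nil => simp at hmem
  | cons a l =>
    rcases List.mem_cons.1 hmem with rfl | hml
    · rfl
    · have h₁ := (List.pairwise_cons.1 hp).1 m hml
      obtain ⟨hax, ham, -⟩ := hχ.ne_of_eq_one h₁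
      have h₂ := hfirst a ham hax
      have h₃ := hχ.swap_outer a x m
      omega

lemma getLast?_eq (hχ : IsOrderType χ) (hm : m ≠ x)
    (hfirst : ∀ v, v ≠ m → v ≠ x → χ m x v = 1) (hs : IsHullSurroundSeq χ x s) {M : V}
    (hM : M ≠ x) (hlast : ∀ v, v ≠ M → v ≠ x → χ v x M = 1) :
    s.getLast? = some M := by
  have hp := hs.pairwise_s12 hχ hm hfirst
  have hmem := (hs.2.1 M).2 hM
  rcases List.eq_nil_or_concat s with rfl | ⟨l, a, rfl⟩
  · simp at hmem
  · rw [List.concat_eq_append] at *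
    rcases List.mem_append.1 hmem with hMl | hMa
    · have h₁ := (List.pairwise_append.1 hp).2.2 M hMl a (by simp)
      obtain ⟨-, hMa, hxa⟩ := hχ.ne_of_eq_one h₁
      have h₂ := hlast a hMa.symm hxa.symm
      have h₃ := hχ.swap_outer a x M
      omega
    · simp_all

end IsHullSurroundSeq

theorem hull_surround_unique {V : Type*} [Fintype V] [DecidableEq V]
    (χ : V → V → V → ℤ) (hn : 4 ≤ Fintype.card V) (hχ : IsOrderType χ)
    (t : ℕ) (h : ZMod t → V) (hhull : IsConvexHullSeq χ t h) (i : ZMod t) :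
    (∃! s : List V, IsHullSurroundSeq χ (h i) s) ∧
      ∀ s : List V, IsHullSurroundSeq χ (h i) s →
        s.head? = some (h (i - 1)) ∧ s.getLast? = some (h (i + 1)) := by
  obtain ⟨ht, hinj, hside⟩ := hhull
  have : Fact (1 < t) := ⟨by omega⟩
  have hm : h (i - 1) ≠ h i := fun e => one_ne_zero (sub_eq_self.1 (hinj e))
  have hM : h (i + 1) ≠ h i := fun e => one_ne_zero (add_eq_left.1 (hinj e))
  have hfirst : ∀ v, v ≠ h (i - 1) → v ≠ h i → χ (h (i - 1)) (h i) v = 1 := by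
    simpa using hside (i - 1)
  have hlast : ∀ v, v ≠ h (i + 1) → v ≠ h i → χ v (h i) (h (i + 1)) = 1 := by
    intro v hv hv'
    rw [← hχ.rotate]
    exact hside i v hv' hv
  obtain ⟨s, hs⟩ := IsHullSurroundSeq.exists_of_first hχ hm hfirst
  exact ⟨⟨s, hs, fun s' hs' => hs'.unique hχ hm hfirst hs⟩, fun s' hs' =>
    ⟨hs'.head?_eq hχ hm hfirst, hs'.getLast?_eq hχ hm hfirst hM hlast⟩⟩
end

section
/- Let χ be an order type in general position on a finite set V with |V| = n ≥ 4 that has a convex hull sequence, and let v be a non-hull element of χ. Then there exists an internal surrounding sequence of v, and any two internal surrounding sequences of v are cyclic shifts of one another. -/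
/-- A tournament on `V \ {v}` in which the out-neighbourhood and the in-neighbourhood of
every vertex contain no cyclic triangle. -/
structure IsLocallyTransitive {V : Type*} (v : V) (R : V → V → Prop) : Prop where
  ne_left : ∀ {a b}, R a b → a ≠ v
  ne_right : ∀ {a b}, R a b → b ≠ v
  asymm : ∀ {a b}, R a b → ¬R b a
  total : ∀ {a b}, a ≠ v → b ≠ v → a ≠ b → R a b ∨ R b a
  out_acyclic : ∀ {a b c d}, R a b → R a c → R a d → R b c → R c d → ¬R d b
  in_acyclic : ∀ {a b c d}, R b a → R c a → R d a → R b c → R c d → ¬R d b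

namespace IsLocallyTransitive

variable {V : Type*} {v : V} {R : V → V → Prop}

theorem ne (hR : IsLocallyTransitive v R) {a b : V} (h : R a b) : a ≠ b := by
  rintro rfl
  exact hR.asymm h h

theorem out_trans (hR : IsLocallyTransitive v R) {a b c d : V} (hb : R a b) (hc : R a c)
    (hd : R a d) (hbc : R b c) (hcd : R c d) : R b d := by
  have hbd : b ≠ d := by
    rintro rfl
    exact hR.asymm hbc hcd
  exact (hR.total (hR.ne_right hb) (hR.ne_right hd) hbd).resolve_right
    (hR.out_acyclic hb hc hd hbc hcd)

theorem in_trans (hR : IsLocallyTransitive v R) {a b c d : V} (hb : R b a) (hc : R c a)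
    (hd : R d a) (hbc : R b c) (hcd : R c d) : R b d := by
  have hbd : b ≠ d := by
    rintro rfl
    exact hR.asymm hbc hcd
  exact (hR.total (hR.ne_left hb) (hR.ne_left hd) hbd).resolve_right
    (hR.in_acyclic hb hc hd hbc hcd)

/-- A finite set on which the tournament is transitive can be listed in increasing order. -/
theorem exists_sorted_list [DecidableEq V] (hR : IsLocallyTransitive v R) (S : Finset V)
    (hv : v ∉ S) (ht : ∀ a ∈ S, ∀ b ∈ S, ∀ c ∈ S, R a b → R b c → R a c) :
    ∃ l : List V, (∀ x, x ∈ l ↔ x ∈ S) ∧ l.Pairwise R := by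
  classical
  induction S using Finset.induction_on with
  | empty => exact ⟨[], by simp⟩
  | insert x S hx ih =>
    obtain ⟨l, hl, hp⟩ := ih (by grind) (by grind)
    refine ⟨l.filter (fun y => R y x) ++ x :: l.filter (fun y => R x y), ?_, ?_⟩
    · intro y
      have := @hR.total x y
      grind
    · rw [List.pairwise_append, List.pairwise_cons]
      refine ⟨hp.filter _, ⟨by grind, hp.filter _⟩, ?_⟩
      grind

/-- The tournament has no directed cycle inside a set on which it is transitive. -/
theorem not_cyclic_of_trans (hR : IsLocallyTransitive v R) {t : ℕ} {h : ZMod t → V}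
    (ht : t ≠ 0) (hh : ∀ i, R (h (i + 1)) (h i))
    (htr : ∀ i j k, R (h i) (h j) → R (h j) (h k) → R (h i) (h k)) : False := by
  have key : ∀ k : ℕ, R (h ((k + 1 : ℕ) : ZMod t)) (h 0) := by
    intro k
    induction k with
    | zero => simpa using hh 0
    | succ k ih =>
      refine htr _ _ _ ?_ ih
      simpa using hh ((k + 1 : ℕ) : ZMod t)
  obtain ⟨k, rfl⟩ := Nat.exists_eq_succ_of_ne_zero ht
  have := key k
  rw [ZMod.natCast_self] at this
  exact hR.ne this rfl

theorem exists_out (hR : IsLocallyTransitive v R) {t : ℕ} {h : ZMod t → V}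
    (ht : t ≠ 0) (hh : ∀ i, R (h (i + 1)) (h i)) {a : V} (ha : a ≠ v) : ∃ b, R a b := by
  by_contra! hno
  have hin : ∀ i, R (h i) a := fun i => by
    have h1 := hh (i - 1)
    rw [sub_add_cancel] at h1
    exact (hR.total (hR.ne_left h1) ha (by rintro rfl; exact hno _ h1)).resolve_right (hno _)
  exact hR.not_cyclic_of_trans ht hh fun i j k => hR.in_trans (hin i) (hin j) (hin k)

theorem exists_in (hR : IsLocallyTransitive v R) {t : ℕ} {h : ZMod t → V}
    (ht : t ≠ 0) (hh : ∀ i, R (h (i + 1)) (h i)) {a : V} (ha : a ≠ v) : ∃ b, R b a := by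
  by_contra! hno
  have hout : ∀ i, R a (h i) := fun i => by
    have h1 := hh i
    exact (hR.total ha (hR.ne_right h1) (by rintro rfl; exact hno _ h1)).resolve_right (hno _)
  exact hR.not_cyclic_of_trans ht hh fun i j k => hR.out_trans (hout i) (hout j) (hout k)

/-- In a cyclic enumeration with one sign change, the successor `u (i + 1)` of `u i` comes
first among all out-neighbours of `u i`. -/
theorem succ_first (hR : IsLocallyTransitive v R) {m p : ℕ} {u : ℕ → V}
    (hchain : ∀ j, j + 1 < m → R (u j) (u (j + 1)))
    (hp : p + 1 < m) (hpos : ∀ j, 0 < j → j ≤ p → R (u 0) (u j))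
    (hneg : ∀ j, p < j → j < m → R (u j) (u 0))
    {i k : ℕ} (hi : i < m) (hk : k < m) (hik : R (u i) (u k)) :
    ¬R (u k) (u ((i + 1) % m)) := by
  have sortP : ∀ j i, 0 < i → i < j → j ≤ p → R (u i) (u j) := by
    intro j
    induction j with
    | zero => omega
    | succ j ih =>
      intro i h0 hij hj
      have hc := hchain j (by omega)
      rcases Nat.lt_succ_iff_lt_or_eq.1 hij with h | rfl
      · exact hR.out_trans (hpos i h0 (by omega)) (hpos j (by omega) (by omega))
          (hpos _ (by omega) hj) (ih i h0 h (by omega)) hc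
      · exact hc
  have sortQ : ∀ j i, p < i → i < j → j < m → R (u i) (u j) := by
    intro j
    induction j with
    | zero => omega
    | succ j ih =>
      intro i h0 hij hj
      have hc := hchain j (by omega)
      rcases Nat.lt_succ_iff_lt_or_eq.1 hij with h | rfl
      · exact hR.in_trans (hneg i h0 (by omega)) (hneg j (by omega) (by omega))
          (hneg _ (by omega) hj) (ih i h0 h (by omega)) hc
      · exact hc
  intro hk'
  have hne : i ≠ k := by
    rintro rfl
    exact hR.ne hik rfl
  by_cases him : i + 1 = m
  · rw [him, Nat.mod_self] at hk'
    rcases Nat.lt_or_ge p k with h | h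
    · exact hR.asymm hik (sortQ i k h (by omega) hi)
    · rcases Nat.eq_zero_or_pos k with rfl | h0
      · exact hR.ne hk' rfl
      · exact hR.asymm hk' (hpos k h0 h)
  · rw [Nat.mod_eq_of_lt (by omega)] at hk'
    have hne' : i + 1 ≠ k := by
      rintro rfl
      exact hR.ne hk' rfl
    have hc := hchain i (by omega)
    rcases Nat.eq_zero_or_pos i with rfl | hi0
    · rcases Nat.lt_or_ge p k with h | h
      · exact hR.asymm hik (hneg k h hk)
      · exact hR.asymm hk' (sortP k _ (by omega) (by omega) h)
    rcases Nat.eq_zero_or_pos k with rfl | hk0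
    · rcases Nat.lt_or_ge p i with h | h
      · exact hR.asymm hk' (hneg _ (by omega) (by omega))
      · exact hR.asymm hik (hpos i hi0 h)
    rcases Nat.lt_or_ge p i with hpi | hpi
    · rcases Nat.lt_or_ge p k with hpk | hpk
      · rcases Nat.lt_or_ge k i with h | h
        · exact hR.asymm hik (sortQ i k hpk h hi)
        · exact hR.asymm hk' (sortQ k _ (by omega) (by omega) hk)
      · exact hR.out_acyclic hc (hneg i hpi hi) hik (hneg _ (by omega) (by omega))
          (hpos k hk0 hpk) hk'
    · rcases Nat.lt_or_ge p k with hpk | hpk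
      · rcases Nat.lt_or_ge p (i + 1) with h | h
        · exact hR.asymm hk' (sortQ k _ h (by omega) hk)
        · exact hR.in_acyclic (hpos _ (by omega) h) hc hk' (hpos i hi0 hpi) hik (hneg k hpk hk)
      · rcases Nat.lt_or_ge k i with h | h
        · exact hR.asymm hik (sortP i k hk0 h hpi)
        · exact hR.asymm hk' (sortP k _ (by omega) (by omega) hpk)

end IsLocallyTransitive

namespace IsOrderType

variable {V : Type*} {χ : V → V → V → ℤ}

theorem eq_neg_one_iff (hχ : IsOrderType χ) {v a b : V} : χ a v b = -1 ↔ χ b v a = 1 := by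
  obtain ⟨-, -, h3, h4, -⟩ := hχ
  have h1 := h3 v a b
  have h2 := h4 v a b
  have h5 := h3 v b a
  omega

theorem isLocallyTransitive (hχ : IsOrderType χ) (v : V) :
    IsLocallyTransitive v (fun a b => χ a v b = 1) := by
  have hswap := fun a b => hχ.eq_neg_one_iff (v := v) (a := a) (b := b)
  obtain ⟨h1, h2, h3, h4, h5⟩ := hχ
  have hl : ∀ {a b}, χ a v b = 1 → a ≠ v := fun {a b} h e => by
    have := h2 a v b (Or.inl e); omega
  have hr : ∀ {a b}, χ a v b = 1 → b ≠ v := fun {a b} h e => by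
    have := h2 a v b (Or.inr (Or.inr e.symm)); omega
  have hne : ∀ {a b}, χ a v b = 1 → a ≠ b := fun {a b} h e => by
    have := h2 a v b (Or.inr (Or.inl e)); omega
  have hpos : ∀ {a b}, χ a v b = 1 → χ v a b = -1 := fun {a b} h => by
    have := h3 a v b; omega
  have hneg : ∀ {a b}, χ b v a = 1 → χ v a b = 1 := fun {a b} h => by
    have := h3 a v b; have := (hswap a b).2 h; omega
  refine ⟨hl, hr, ?_, ?_, ?_, ?_⟩
  · intro a b h h'
    have := (hswap a b).2 h'
    omega
  · intro a b ha hb hab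
    exact (h1 a v b ha hab hb.symm).imp id (hswap a b).1
  · intro a b c d hb hc hd hbc hcd hdb
    have := h5 v a b c d (hl hb).symm (hr hb).symm (hr hc).symm (hr hd).symm (hne hb) (hne hc)
      (hne hd) (hne hbc) (hne hdb).symm (hne hcd)
    rw [hpos hb, hpos hc, hpos hd, hpos hbc, hpos hcd, hneg hdb] at this
    omega
  · intro a b c d hb hc hd hbc hcd hdb
    have := h5 v a b c d (hr hb).symm (hl hb).symm (hl hc).symm (hl hd).symm (hne hb).symm
      (hne hc).symm (hne hd).symm (hne hbc) (hne hdb).symm (hne hcd)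
    rw [hneg hb, hneg hc, hneg hd, hpos hbc, hpos hcd, hneg hdb] at this
    omega

end IsOrderType

/-- Successors in an internal surrounding sequence, characterised independently of it. -/
theorem IsInternalSurroundSeq.succ_spec {V : Type*} {χ : V → V → V → ℤ} {v : V}
    (hχ : IsOrderType χ) {s : List V} (hs : IsInternalSurroundSeq χ v s) {i : ℕ}
    (hi : i < s.length) :
    χ s[i] v (s[(i + 1) % s.length]'(Nat.mod_lt _ (by omega))) = 1 ∧
      ∀ z, χ s[i] v z = 1 →
        ¬χ z v (s[(i + 1) % s.length]'(Nat.mod_lt _ (by omega))) = 1 := by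
  have hR := hχ.isLocallyTransitive v
  obtain ⟨-, hmem, hchain, hlast, p, ⟨hp0, hpm, hpos, hneg⟩, -⟩ := hs
  have hget : ∀ {j} (hj : j < s.length), s.getD j v = s[j] := fun hj => by simp [hj]
  have hchain' : ∀ j, j + 1 < s.length → χ (s.getD j v) v (s.getD (j + 1) v) = 1 := by
    intro j hj
    rw [hget hj, hget (by omega)]
    exact List.isChain_iff_getElem.1 hchain j hj
  have hlast' : χ (s.getD (s.length - 1) v) v (s.getD 0 v) = 1 := by
    rw [hget (by omega), hget (by omega)]
    refine hlast _ _ ?_ ?_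
    · rw [List.getLast?_eq_getElem?, List.getElem?_eq_getElem (by omega)]
    · rw [List.head?_eq_getElem?, List.getElem?_eq_getElem (by omega)]
  constructor
  · by_cases him : i + 1 = s.length
    · have h := hlast'
      rw [hget (by omega), hget (by omega)] at h
      simpa [him, show s.length - 1 = i by omega] using h
    · have h := hchain' i (by omega)
      rw [hget (by omega), hget (by omega)] at h
      simpa [Nat.mod_eq_of_lt (show i + 1 < s.length by omega)] using h
  · intro z hz
    obtain ⟨k, hk, rfl⟩ := List.getElem_of_mem ((hmem z).2 (hR.ne_right hz))
    have := hR.succ_first (u := fun j => s.getD j v) hchain' hpm hpos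
      (fun j h1 h2 => hχ.eq_neg_one_iff.1 (hneg j h1 h2)) hi hk (by simpa [hi, hk] using hz)
    rwa [hget hk, hget (Nat.mod_lt _ (by omega))] at this

theorem IsInternalSurroundSeq.eq_rotate {V : Type*} {χ : V → V → V → ℤ} {v : V}
    (hχ : IsOrderType χ) {s s' : List V} (hs : IsInternalSurroundSeq χ v s)
    (hs' : IsInternalSurroundSeq χ v s') : ∃ k : ℕ, s' = s.rotate k := by
  have hR := hχ.isLocallyTransitive v
  have hlen : s.length = s'.length :=
    ((List.perm_ext_iff_of_nodup hs.1 hs'.1).2 fun x => (hs.2.1 x).trans (hs'.2.1 x).symm).length_eq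
  have hm : 0 < s.length := by
    obtain ⟨p, ⟨-, h, -⟩, -⟩ := hs.2.2.2.2
    omega
  obtain ⟨k, hk, hk0⟩ := List.getElem_of_mem
    ((hs.2.1 s'[0]).2 ((hs'.2.1 s'[0]).1 (List.getElem_mem (by omega))))
  have key : ∀ j (hj : j < s'.length), s'[j] = s[(j + k) % s.length]'(Nat.mod_lt _ hm) := by
    intro j
    induction j with
    | zero =>
      intro hj
      simp only [Nat.zero_add, Nat.mod_eq_of_lt hk, hk0]
    | succ j ih =>
      intro hj
      have e := ih (by omega)
      obtain ⟨h1, h2⟩ := hs'.succ_spec hχ (i := j) (by omega)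
      obtain ⟨h3, h4⟩ := hs.succ_spec hχ (Nat.mod_lt (j + k) hm)
      simp only [Nat.mod_eq_of_lt hj, Nat.mod_add_mod, ← e,
        show j + k + 1 = j + 1 + k by omega] at h1 h2 h3 h4
      by_contra hne
      exact (hR.total (hR.ne_right h1) (hR.ne_right h3) hne).elim (h4 _ h1) (h2 _ h3)
  refine ⟨k, List.ext_getElem (by simp [hlen]) fun j h1 _ => ?_⟩
  rw [List.getElem_rotate]
  exact key j h1

theorem exists_isInternalSurroundSeq {V : Type*} [Fintype V] [DecidableEq V]
    {χ : V → V → V → ℤ} (hχ : IsOrderType χ) {v : V}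
    (hout : ∀ a, a ≠ v → ∃ b, χ a v b = 1) (hin : ∀ a, a ≠ v → ∃ b, χ b v a = 1)
    {a : V} (ha : a ≠ v) : ∃ s : List V, IsInternalSurroundSeq χ v s := by
  have hR := hχ.isLocallyTransitive v
  obtain ⟨P, hP, hPs⟩ := hR.exists_sorted_list (Finset.univ.filter fun b => χ a v b = 1)
    (fun h => hR.ne_right (Finset.mem_filter.1 h).2 rfl)
    (by simpa using fun b hb c hc d hd => hR.out_trans hb hc hd)
  obtain ⟨Q, hQ, hQs⟩ := hR.exists_sorted_list (Finset.univ.filter fun b => χ b v a = 1)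
    (fun h => hR.ne_left (Finset.mem_filter.1 h).2 rfl)
    (by simpa using fun b hb c hc d hd => hR.in_trans hb hc hd)
  simp only [Finset.mem_filter, Finset.mem_univ, true_and] at hP hQ
  have hP0 : P ≠ [] := by
    obtain ⟨b, hb⟩ := hout a ha
    exact List.ne_nil_of_mem ((hP b).2 hb)
  have hQ0 : Q ≠ [] := by
    obtain ⟨b, hb⟩ := hin a ha
    exact List.ne_nil_of_mem ((hQ b).2 hb)
  -- The last out-neighbour `b` of `a` precedes the first in-neighbour `c` of `a`.
  have hjoin : χ (P.getLast hP0) v (Q.head hQ0) = 1 := by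
    have hb := (hP _).1 (List.getLast_mem hP0)
    have hc := (hQ _).1 (List.head_mem hQ0)
    have hbl : ∀ d ∈ P, d ≠ P.getLast hP0 → χ d v (P.getLast hP0) = 1 := by
      intro d hd hne
      rw [← List.dropLast_append_getLast hP0] at hd hPs
      simp only [List.mem_append, List.mem_singleton, hne, or_false] at hd
      exact (List.pairwise_append.1 hPs).2.2 d hd _ (by simp)
    have hcf : ∀ d ∈ Q, d ≠ Q.head hQ0 → χ (Q.head hQ0) v d = 1 := by
      intro d hd hne
      rw [← List.cons_head_tail hQ0] at hd hQs
      simp only [List.mem_cons, hne, false_or] at hd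
      exact (List.pairwise_cons.1 hQs).1 d hd
    refine (hR.total (hR.ne_right hb) (hR.ne_left hc) ?_).resolve_right fun hcb => ?_
    · intro e
      exact hR.asymm hb (e ▸ hc)
    · obtain ⟨d, hd⟩ := hout _ (hR.ne_right hb)
      have hda : χ d v a = 1 := by
        refine (hR.total ha (hR.ne_right hd) ?_).resolve_left fun h => ?_
        · rintro rfl
          exact hR.asymm hb hd
        · exact hR.asymm hd (hbl d ((hP d).2 h) (hR.ne hd).symm)
      have hcd := hcf d ((hQ d).2 hda) (by rintro rfl; exact hR.asymm hcb hd)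
      exact hR.out_acyclic hc hcb hcd hb hd hda
  have hsplit : ∀ x ∈ P, x ∉ Q := fun x hx hx' => hR.asymm ((hP x).1 hx) ((hQ x).1 hx')
  have hPl := List.length_pos_iff.2 hP0
  have hQl := List.length_pos_iff.2 hQ0
  have hpos : ∀ j, 0 < j → j ≤ P.length → χ a v ((a :: (P ++ Q)).getD j v) = 1 := by
    intro j h1 h2
    obtain ⟨j, rfl⟩ := Nat.exists_eq_succ_of_ne_zero h1.ne'
    rw [← hP, List.getD_cons_succ, List.getD_append _ _ _ _ (by omega),
      List.getD_eq_getElem _ _ (by omega)]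
    exact List.getElem_mem _
  have hneg : ∀ j, P.length < j → j < (a :: (P ++ Q)).length →
      χ a v ((a :: (P ++ Q)).getD j v) = -1 := by
    intro j h1 h2
    obtain ⟨j, rfl⟩ := Nat.exists_eq_succ_of_ne_zero (by omega : j ≠ 0)
    simp only [List.length_cons, List.length_append] at h2
    rw [hχ.eq_neg_one_iff, ← hQ, List.getD_cons_succ, List.getD_append_right _ _ _ _ (by omega),
      List.getD_eq_getElem _ _ (by omega)]
    exact List.getElem_mem _
  refine ⟨a :: (P ++ Q), ?_, ?_, ?_, ?_, P.length, ⟨hPl, ?_, hpos, hneg⟩, ?_⟩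
  · rw [List.nodup_cons, List.nodup_append']
    refine ⟨?_, hPs.imp hR.ne, hQs.imp hR.ne, hsplit⟩
    rw [List.mem_append, hP, hQ, or_self]
    exact fun h => hR.ne h rfl
  · intro x
    simp only [List.mem_cons, List.mem_append, hP, hQ]
    constructor
    · rintro (rfl | h | h)
      exacts [ha, hR.ne_right h, hR.ne_left h]
    · intro hx
      by_cases hxa : x = a
      · exact Or.inl hxa
      · exact Or.inr (hR.total ha hx (Ne.symm hxa))
  · change List.IsChain _ _
    rw [List.isChain_cons, List.isChain_append]
    refine ⟨?_, hPs.isChain, hQs.isChain, ?_⟩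
    · intro y hy
      rw [List.head?_append_of_ne_nil _ hP0] at hy
      exact (hP y).1 (List.mem_of_mem_head? hy)
    · intro x hx y hy
      rw [List.getLast?_eq_getLast_of_ne_nil hP0] at hx
      rw [List.head?_eq_some_head hQ0] at hy
      simp only [Option.mem_def, Option.some.injEq] at hx hy
      rwa [← hx, ← hy]
  · intro x y hx hy
    rw [List.head?_cons, Option.some.injEq] at hy
    rw [← List.cons_append, List.getLast?_append_of_ne_nil _ hQ0] at hx
    exact hy ▸ (hQ x).1 (List.mem_of_getLast? hx)
  · simp only [List.length_cons, List.length_append]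
    omega
  · rintro q ⟨hq0, hq1, hq2, hq3⟩
    rw [List.getD_cons_zero] at hq2 hq3
    rcases lt_trichotomy q P.length with h | h | h
    · have h1 := hq3 (q + 1) (by omega) (by omega)
      rw [hpos (q + 1) (by omega) (by omega)] at h1
      omega
    · exact h
    · have h1 := hq2 q hq0 le_rfl
      rw [hneg q h (by omega)] at h1
      omega

theorem internal_surround_exists_unique {V : Type*} [Fintype V] [DecidableEq V]
    (χ : V → V → V → ℤ) (hn : 4 ≤ Fintype.card V) (hχ : IsOrderType χ)
    (hex : ∃ (t : ℕ) (h : ZMod t → V), IsConvexHullSeq χ t h)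
    (v : V) (hv : ¬IsHullElement χ v) :
    (∃ s : List V, IsInternalSurroundSeq χ v s) ∧
      ∀ s s' : List V, IsInternalSurroundSeq χ v s → IsInternalSurroundSeq χ v s' →
        ∃ k : ℕ, s' = s.rotate k := by
  refine ⟨?_, fun s s' hs hs' => hs.eq_rotate hχ hs'⟩
  obtain ⟨t, h, hh⟩ := hex
  have hR := hχ.isLocallyTransitive v
  have hvh : ∀ i, v ≠ h i := fun i e => hv ⟨t, h, hh, i, e.symm⟩
  have ht : t ≠ 0 := by have := hh.1; omega
  have hstep : ∀ i, χ (h (i + 1)) v (h i) = 1 := fun i => by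
    have h1 := hh.2.2 i v (hvh _) (hvh _)
    have h2 := hχ.2.2.2.1 (h i) (h (i + 1)) v
    exact hχ.eq_neg_one_iff.1 (by omega)
  exact exists_isInternalSurroundSeq hχ (fun _ ha => hR.exists_out ht hstep ha)
    (fun _ ha => hR.exists_in ht hstep ha) (hvh 0).symm
end

section
/- Let χ be an order type in general position on a finite set V with |V| = n ≥ 4. Then any two convex hull sequences of χ have the same length and are cyclic rotations of one another; in particular, the convex hull of χ is uniquely determined by the property χ(h_i, h_{i+1}, v) = +1 for all v ∈ V ∖ {h_i, h_{i+1}} and all i. -/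
/-- Around `x`, the relation `χ x a b = 1` is transitive on the elements on the positive side
of a line through `x` and `y`. -/
theorem IsOrderType.trans_of_pos {V : Type*} {χ : V → V → V → ℤ} (hχ : IsOrderType χ)
    {x y a b c : V} (hxy : x ≠ y) (hxa : x ≠ a) (hxb : x ≠ b) (hxc : x ≠ c)
    (hya : y ≠ a) (hyb : y ≠ b) (hyc : y ≠ c) (hab : a ≠ b) (hac : a ≠ c) (hbc : b ≠ c)
    (ha : χ x y a = 1) (hb : χ x y b = 1) (hc : χ x y c = 1)
    (h₁ : χ x a b = 1) (h₂ : χ x b c = 1) : χ x a c = 1 := by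
  have h := (hχ.2.2.2.2 x y a b c hxy hxa hxb hxc hya hyb hyc hab hac hbc).1
  rw [ha, hb, hc, h₁, h₂] at h
  omega

theorem IsConvexHullSeq.add_one_ne {V : Type*} {χ : V → V → V → ℤ} {t : ℕ} {h : ZMod t → V}
    (hh : IsConvexHullSeq χ t h) (i : ZMod t) : h (i + 1) ≠ h i := by
  have : Fact (1 < t) := ⟨by have := hh.1; omega⟩
  intro e
  simpa using hh.2.1 e

/-- Two convex hull sequences of the same order type share an element. -/
theorem IsConvexHullSeq.exists_eq {V : Type*} {χ : V → V → V → ℤ} (hχ : IsOrderType χ)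
    {t t' : ℕ} {h : ZMod t → V} {h' : ZMod t' → V}
    (hh : IsConvexHullSeq χ t h) (hh' : IsConvexHullSeq χ t' h') :
    ∃ a b, h' a = h b := by
  by_contra! hne
  obtain ⟨ht, hinj, hpos⟩ := hh
  have hcast : ∀ i j : ℕ, i < t → j < t → i ≠ j → h (i : ZMod t) ≠ h (j : ZMod t) := by
    intro i j hi hj hij e
    have := (ZMod.natCast_eq_natCast_iff' _ _ _).1 (hinj e)
    rw [Nat.mod_eq_of_lt hi, Nat.mod_eq_of_lt hj] at this
    exact hij this
  have hline : ∀ i, χ (h' 0) (h' (0 + 1)) (h i) = 1 := fun i =>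
    hh'.2.2 0 (h i) (hne _ _).symm (hne _ _).symm
  have hsucc : ∀ i, χ (h' 0) (h i) (h (i + 1)) = 1 := by
    intro i
    have h₁ := hpos i (h' 0) (hne _ _) (hne _ _)
    have h₂ := hχ.2.2.1 (h' 0) (h i) (h (i + 1))
    have h₃ := hχ.2.2.2.1 (h i) (h (i + 1)) (h' 0)
    omega
  have hfirst : ∀ j : ℕ, 1 ≤ j → j < t → χ (h' 0) (h (0 : ℕ)) (h j) = 1 := by
    intro j hj
    induction j, hj using Nat.le_induction with
    | base => intro _; simpa using hsucc 0
    | succ j hj ih =>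
      intro hjt
      have hstep := hsucc (j : ZMod t)
      rw [← Nat.cast_succ] at hstep
      exact hχ.trans_of_pos (hh'.add_one_ne 0).symm (hne _ _) (hne _ _) (hne _ _)
        (hne _ _) (hne _ _) (hne _ _)
        (hcast _ _ (by omega) (by omega) (by omega))
        (hcast _ _ (by omega) (by omega) (by omega))
        (hcast _ _ (by omega) (by omega) (by omega))
        (hline _) (hline _) (hline _) (ih (by omega)) hstep
  have hlast := hfirst (t - 1) (by omega) (by omega)
  have hwrap := hsucc ((t - 1 : ℕ) : ZMod t)
  have hzero : ((t - 1 : ℕ) : ZMod t) + 1 = ((0 : ℕ) : ZMod t) := by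
    rw [← Nat.cast_succ, Nat.succ_eq_add_one, Nat.sub_add_cancel (by omega)]
    simp
  rw [hzero, hχ.2.2.2.1, hlast] at hwrap
  omega

/-- The successor of an element in a convex hull sequence does not depend on the sequence. -/
theorem IsConvexHullSeq.succ_eq {V : Type*} {χ : V → V → V → ℤ} (hχ : IsOrderType χ)
    {t t' : ℕ} {h : ZMod t → V} {h' : ZMod t' → V}
    (hh : IsConvexHullSeq χ t h) (hh' : IsConvexHullSeq χ t' h')
    {a : ZMod t'} {b : ZMod t} (e : h' a = h b) : h' (a + 1) = h (b + 1) := by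
  by_contra hne
  have h₁ := hh.2.2 b (h' (a + 1)) (e ▸ hh'.add_one_ne a) hne
  have h₂ := hh'.2.2 a (h (b + 1)) (e ▸ hh.add_one_ne b) (Ne.symm hne)
  rw [e, hχ.2.2.2.1, h₁] at h₂
  omega

theorem IsConvexHullSeq.add_natCast_eq {V : Type*} {χ : V → V → V → ℤ} (hχ : IsOrderType χ)
    {t t' : ℕ} {h : ZMod t → V} {h' : ZMod t' → V}
    (hh : IsConvexHullSeq χ t h) (hh' : IsConvexHullSeq χ t' h')
    {a : ZMod t'} {b : ZMod t} (e : h' a = h b) (m : ℕ) : h' (a + m) = h (b + m) := by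
  induction m with
  | zero => simpa using e
  | succ m ih => simpa [add_assoc] using hh.succ_eq hχ hh' ih

theorem IsConvexHullSeq.length_dvd {V : Type*} {χ : V → V → V → ℤ} (hχ : IsOrderType χ)
    {t t' : ℕ} {h : ZMod t → V} {h' : ZMod t' → V}
    (hh : IsConvexHullSeq χ t h) (hh' : IsConvexHullSeq χ t' h')
    {a : ZMod t'} {b : ZMod t} (e : h' a = h b) : t ∣ t' := by
  have key := hh.add_natCast_eq hχ hh' e t'
  rw [ZMod.natCast_self, add_zero, e] at key
  rw [← ZMod.natCast_eq_zero_iff]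
  simpa using (hh.2.1 key).symm

theorem convex_hull_seq_unique {V : Type*} [Fintype V] [DecidableEq V]
    (χ : V → V → V → ℤ) (hn : 4 ≤ Fintype.card V) (hχ : IsOrderType χ)
    (t t' : ℕ) (h : ZMod t → V) (h' : ZMod t' → V)
    (hhull : IsConvexHullSeq χ t h) (hhull' : IsConvexHullSeq χ t' h') :
    t = t' ∧ ∃ k : ℕ, ∀ j : ℕ, h' (j : ZMod t') = h ((j + k : ℕ) : ZMod t) := by
  obtain ⟨a, b, e⟩ := hhull.exists_eq hχ hhull'
  obtain rfl : t = t' := Nat.dvd_antisymm (hhull.length_dvd hχ hhull' e)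
    (hhull'.length_dvd hχ hhull e.symm)
  have : NeZero t := ⟨by have := hhull.1; omega⟩
  refine ⟨rfl, (b - a).val, fun j => ?_⟩
  have key := hhull.add_natCast_eq hχ hhull' e ((j : ZMod t) - a).val
  rw [ZMod.natCast_zmod_val, add_sub_cancel] at key
  rw [key, Nat.cast_add, ZMod.natCast_zmod_val]
  congr 1
  ring
end
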